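/- arXiv:1701.05965 — 2 statements merged into one kernel-verified Lean document; each statement's English description precedes it below -/
import Mathlib

section
/- Let m ≥ 4 be even and let e = m/2. Then the dual code C̄_e^⊥ has 𝔽₂-dimension 1 + 3m/2, and its weight distribution is: exactly 1 codeword each of weights 0 and 2^m; exactly (2^{m/2}−1)·2^m codewords of weight 2^{m−1}−2^{(m−2)/2}; exactly (2^{m/2}−1)·2^m codewords of weight 2^{m−1}+2^{(m−2)/2}; exactly 2^{m+1}−2 codewords of weight 2^{m−1}; and no codewords of any other weight. In particular the minimum distance of C̄_e^⊥ is 2^{m−1}−2^{(m−2)/2}. -/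
noncomputable local instance (m : ℕ) : Fintype (GaloisField 2 m) := Fintype.ofFinite _
attribute [local instance] Classical.propDecidable

/-- `∑_{g∈F} ι(c(g))·g^s ∈ F = GF(2^m)`, where `ι : 𝔽₂ → F` is the unique ring hom. -/
noncomputable def phiF (m s : ℕ) :
    (GaloisField 2 m → ZMod 2) →ₗ[ZMod 2] GaloisField 2 m where
  toFun c := ∑ g, algebraMap (ZMod 2) (GaloisField 2 m) (c g) * g ^ s
  map_add' c d := by simp [add_mul, Finset.sum_add_distrib]
  map_smul' a c := by simp [Algebra.smul_def, mul_assoc, Finset.mul_sum]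

/-- The parity functional `c ↦ ∑_{g∈F} c(g) ∈ 𝔽₂`. -/
noncomputable def parF (m : ℕ) : (GaloisField 2 m → ZMod 2) →ₗ[ZMod 2] ZMod 2 where
  toFun c := ∑ g, c g
  map_add' c d := by simp [Finset.sum_add_distrib]
  map_smul' a c := by simp [Finset.mul_sum]

/-- The extended binary cyclic code `C̄_e` of length `2^m`, with coordinates indexed by
`F = GF(2^m)`: all `c : F → 𝔽₂` with `∑_{g∈F} c(g) = 0` in `𝔽₂`,
`∑_{g∈F} ι(c(g))·g = 0` and `∑_{g∈F} ι(c(g))·g^{2^e+1} = 0` in `F`. -/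
noncomputable def extCode (m e : ℕ) : Submodule (ZMod 2) (GaloisField 2 m → ZMod 2) :=
  LinearMap.ker (parF m) ⊓ LinearMap.ker (phiF m 1) ⊓ LinearMap.ker (phiF m (2 ^ e + 1))

/-- The dual code `C̄_e^⊥`. -/
noncomputable def dualCode (m e : ℕ) : Submodule (ZMod 2) (GaloisField 2 m → ZMod 2) where
  carrier := {y | ∀ c ∈ extCode m e, ∑ g, c g * y g = 0}
  add_mem' := by
    intro a b ha hb c hc
    simp only [Pi.add_apply, mul_add, Finset.sum_add_distrib, ha c hc, hb c hc, add_zero]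
  zero_mem' := by intro c hc; simp
  smul_mem' := by
    intro a y hy c hc
    simp only [Pi.smul_apply, smul_eq_mul, mul_left_comm, ← Finset.mul_sum, hy c hc, mul_zero]

/-- The Hamming weight of a codeword. -/
noncomputable def wt {m : ℕ} (y : GaloisField 2 m → ZMod 2) : ℕ :=
  (Finset.univ.filter fun g => y g ≠ 0).card

/-- The nontrivial additive character `𝔽₂ → {±1}`, with integer values. -/
def signChar (x : ZMod 2) : ℤ := (-1) ^ x.val

lemma signChar_add (x y : ZMod 2) : signChar (x + y) = signChar x * signChar y := by
  revert x y; decide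

lemma signChar_mul_self (x : ZMod 2) : signChar x * signChar x = 1 := by
  revert x; decide

lemma signChar_eq_ite (x : ZMod 2) : signChar x = 1 - 2 * (if x ≠ 0 then 1 else 0) := by
  revert x; decide

lemma sum_signChar {α : Type*} [Fintype α] (y : α → ZMod 2) :
    ∑ g, signChar (y g) =
      Fintype.card α - 2 * ((Finset.univ.filter fun g => y g ≠ 0).card : ℤ) := by
  simp only [signChar_eq_ite, Finset.sum_sub_distrib, ← Finset.mul_sum, Finset.sum_boole]
  simp

/-- Counting through a linear map: fibres over the range all have the size of the kernel. -/
lemma LinearMap.natCard_comp_eq {R V W : Type*} [Ring R] [AddCommGroup V] [Module R V]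
    [AddCommGroup W] [Module R W] [Finite V] [Finite W] (f : V →ₗ[R] W) (P : W → Prop) :
    Nat.card {v // P (f v)} =
      Nat.card {w // w ∈ LinearMap.range f ∧ P w} * Nat.card (LinearMap.ker f) := by
  have fiber (w : {w // w ∈ LinearMap.range f ∧ P w}) :
      Nonempty ({v : {v // P (f v)} // f v = w} ≃ LinearMap.ker f) := by
    obtain ⟨w, ⟨v₀, rfl⟩, hP⟩ := w
    exact ⟨{ toFun := fun v => ⟨v.1.1 - v₀, by simp [v.2]⟩
             invFun := fun u => ⟨⟨u.1 + v₀, by simpa using hP⟩, by simp⟩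
             left_inv := fun v => by ext; simp
             right_inv := fun u => by ext; simp }⟩
  let F (v : {v // P (f v)}) : {w // w ∈ LinearMap.range f ∧ P w} := ⟨f v, ⟨v, rfl⟩, v.2⟩
  rw [← Nat.card_prod]
  refine Nat.card_congr ((Equiv.sigmaFiberEquiv F).symm.trans
    ((Equiv.sigmaCongrRight fun w => ?_).trans (Equiv.sigmaEquivProd _ _)))
  exact (Equiv.subtypeEquivRight fun v => by simp [F, Subtype.ext_iff]).trans (fiber w).some

/-- Complementing words negates character sums, so the weight distribution of a code containing
the all-ones word is symmetric. -/
lemma natCard_sum_signChar_eq_neg {α : Type*} [Fintype α] (C : Submodule (ZMod 2) (α → ZMod 2))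
    (hC : 1 ∈ C) (t : ℤ) :
    Nat.card {y // y ∈ C ∧ ∑ g, signChar (y g) = -t} =
      Nat.card {y // y ∈ C ∧ ∑ g, signChar (y g) = t} := by
  have h1 : signChar 1 = -1 := by decide
  refine Nat.card_congr ((Equiv.addLeft (1 : α → ZMod 2)).subtypeEquiv fun y => ?_)
  simp [C.add_mem_iff_right hC, signChar_add, h1, neg_eq_iff_eq_neg]

lemma natCard_sum_signChar_sq_eq_sq {α : Type*} [Fintype α]
    (C : Submodule (ZMod 2) (α → ZMod 2)) (hC : 1 ∈ C) {t : ℤ} (ht : t ≠ 0) :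
    Nat.card {y // y ∈ C ∧ (∑ g, signChar (y g)) ^ 2 = t ^ 2} =
      2 * Nat.card {y // y ∈ C ∧ ∑ g, signChar (y g) = t} := by
  have hdisj : Disjoint (fun y : α → ZMod 2 => y ∈ C ∧ ∑ g, signChar (y g) = t)
      (fun y => y ∈ C ∧ ∑ g, signChar (y g) = -t) := by
    rw [Pi.disjoint_iff]
    intro y
    rw [Prop.disjoint_iff]
    by_contra! h
    omega
  rw [two_mul]
  nth_rw 2 [← natCard_sum_signChar_eq_neg C hC t]
  rw [← Nat.card_sum]
  refine Nat.card_congr ((Equiv.subtypeEquivRight fun y => ?_).trans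
    (subtypeOrEquiv _ _ hdisj))
  rw [sq_eq_sq_iff_eq_or_eq_neg, and_or_left]

section TraceCode

variable {F : Type*} [Field F] [Fintype F] [Algebra (ZMod 2) F]

local notation "tr" => Algebra.trace (ZMod 2) F

lemma exists_trace_mul_eq (f : F →ₗ[ZMod 2] ZMod 2) : ∃ a, ∀ x, f x = tr (a * x) := by
  refine ⟨((Algebra.traceForm (ZMod 2) F).toDual (traceForm_nondegenerate _ _)).symm f, fun x => ?_⟩
  rw [← Algebra.traceForm_apply, LinearMap.BilinForm.apply_toDual_symm_apply]

lemma sum_signChar_trace_mul (d : F) :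
    ∑ g, signChar (tr (d * g)) = if d = 0 then (Fintype.card F : ℤ) else 0 := by
  split_ifs with hd
  · simp [hd, signChar]
  obtain ⟨g₀, hg₀⟩ : ∃ g, tr (d * g) ≠ 0 := by
    by_contra! h
    exact hd ((traceForm_nondegenerate (ZMod 2) F).1 d h)
  have h1 : tr (d * g₀) = 1 := by
    generalize tr (d * g₀) = z at hg₀
    revert z; decide
  have h2 := Equiv.sum_comp (Equiv.addRight g₀) fun g => signChar (tr (d * g))
  simp only [Equiv.coe_addRight, mul_add, map_add, signChar_add, h1, ← Finset.sum_mul] at h2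
  have : signChar 1 = -1 := by decide
  rw [this] at h2
  linarith

variable [CharP F 2]

/-- The additive map `x ↦ x + x ^ (2 ^ k)`. On a field of order `2 ^ (2 * k)` it is the trace to
the subfield of order `2 ^ k`, and its kernel is that subfield. -/
def frobTrace (F : Type*) [Field F] [CharP F 2] (k : ℕ) : F →+ F where
  toFun x := x + x ^ 2 ^ k
  map_zero' := by simp
  map_add' x y := by rw [add_pow_char_pow]; ring

omit [Fintype F] [Algebra (ZMod 2) F] in
lemma frobTrace_apply (k : ℕ) (x : F) : frobTrace F k x = x + x ^ 2 ^ k := rfl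

omit [Fintype F] [Algebra (ZMod 2) F] in
lemma frobTrace_eq_zero_iff (k : ℕ) (x : F) : frobTrace F k x = 0 ↔ x ^ 2 ^ k = x := by
  rw [frobTrace_apply, CharTwo.add_eq_zero, eq_comm]

variable {k : ℕ}

lemma trace_pow_two_pow (k : ℕ) (x : F) : tr (x ^ 2 ^ k) = tr x := by
  induction k with
  | zero => simp
  | succ k ih =>
    rw [pow_succ, pow_mul, ← ih]
    have := Algebra.trace_eq_of_algEquiv (FiniteField.frobeniusAlgEquiv (ZMod 2) F 2) (x ^ 2 ^ k)
    simpa using this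

omit [Algebra (ZMod 2) F] [CharP F 2] in
lemma pow_two_pow_pow_two_pow (hF : Fintype.card F = 2 ^ (2 * k)) (x : F) :
    (x ^ 2 ^ k) ^ 2 ^ k = x := by
  rw [← pow_mul, ← pow_add, ← two_mul, ← hF, FiniteField.pow_card]

omit [Algebra (ZMod 2) F] in
lemma frobTrace_pow (hF : Fintype.card F = 2 ^ (2 * k)) (x : F) :
    frobTrace F k x ^ 2 ^ k = frobTrace F k x := by
  rw [frobTrace_apply, add_pow_char_pow, pow_two_pow_pow_two_pow hF, add_comm]

omit [Algebra (ZMod 2) F] in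
lemma card_frobTrace_ker_and_range (hk : k ≠ 0) (hF : Fintype.card F = 2 ^ (2 * k)) :
    Nat.card (frobTrace F k).ker = 2 ^ k ∧ (frobTrace F k).range = (frobTrace F k).ker := by
  have hle : (frobTrace F k).range ≤ (frobTrace F k).ker := by
    rintro _ ⟨x, rfl⟩
    rw [AddMonoidHom.mem_ker, frobTrace_eq_zero_iff, frobTrace_pow hF]
  have hq : 1 < 2 ^ k := Nat.one_lt_two_pow hk
  have hker : Nat.card (frobTrace F k).ker ≤ 2 ^ k := by
    classical
    have hsub : ((frobTrace F k).ker : Set F) ⊆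
        ((Polynomial.X ^ 2 ^ k - Polynomial.X : Polynomial F).roots.toFinset : Set F) := by
      intro x hx
      have hx' := (frobTrace_eq_zero_iff k x).1 hx
      simp [FiniteField.X_pow_card_sub_X_ne_zero F hq, hx']
    calc Nat.card (frobTrace F k).ker
        = ((frobTrace F k).ker : Set F).ncard := rfl
      _ ≤ _ := Set.ncard_le_ncard hsub
      _ ≤ _ := by
        rw [Set.ncard_coe_finset]
        exact (Multiset.toFinset_card_le _).trans ((Polynomial.card_roots' _).trans
          (FiniteField.X_pow_card_sub_X_natDegree_eq F hq).le)
  have hprod : Nat.card (frobTrace F k).range * Nat.card (frobTrace F k).ker = 2 ^ k * 2 ^ k := by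
    rw [← pow_add, ← two_mul, ← hF, ← Nat.card_eq_fintype_card, mul_comm,
      ← AddSubgroup.index_ker, AddSubgroup.card_mul_index]
  have hrange : Nat.card (frobTrace F k).range ≤ Nat.card (frobTrace F k).ker :=
    Nat.card_le_card_of_injective _ (AddSubgroup.inclusion_injective hle)
  have heq : Nat.card (frobTrace F k).ker = 2 ^ k := by nlinarith
  refine ⟨heq, AddSubgroup.eq_of_le_of_card_ge hle ?_⟩
  rw [heq] at hprod ⊢
  exact (Nat.eq_of_mul_eq_mul_right (by positivity) hprod).ge

lemma trace_eq_zero_of_pow_eq (hk : k ≠ 0) (hF : Fintype.card F = 2 ^ (2 * k)) {x : F}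
    (hx : x ^ 2 ^ k = x) : tr x = 0 := by
  have hx' : x ∈ (frobTrace F k).range := by
    rw [(card_frobTrace_ker_and_range hk hF).2]
    exact (frobTrace_eq_zero_iff k x).2 hx
  obtain ⟨u, rfl⟩ := hx'
  rw [frobTrace_apply, map_add, trace_pow_two_pow, CharTwo.add_self_eq_zero]

lemma trace_mul_pow_eq_zero (hk : k ≠ 0) (hF : Fintype.card F = 2 ^ (2 * k)) {b : F}
    (hb : frobTrace F k b = 0) (g : F) : tr (b * g ^ (2 ^ k + 1)) = 0 := by
  refine trace_eq_zero_of_pow_eq hk hF ?_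
  rw [pow_succ, mul_pow, mul_pow, (frobTrace_eq_zero_iff k _).1 hb, pow_two_pow_pow_two_pow hF,
    mul_comm g]

/-- The linear map sending `(c, a, b)` to the word `g ↦ c + Tr(a g) + Tr(b g ^ s)`. -/
noncomputable def traceWord (F : Type*) [Field F] [Algebra (ZMod 2) F] (s : ℕ) :
    (ZMod 2 × F × F) →ₗ[ZMod 2] (F → ZMod 2) where
  toFun p g := p.1 + Algebra.trace (ZMod 2) F (p.2.1 * g) +
    Algebra.trace (ZMod 2) F (p.2.2 * g ^ s)
  map_add' p p' := by
    ext g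
    simp only [Prod.fst_add, Prod.snd_add, Pi.add_apply, add_mul, map_add]
    ring
  map_smul' r p := by
    ext g
    simp [mul_add]

omit [Fintype F] [CharP F 2] in
lemma traceWord_apply (s : ℕ) (p : ZMod 2 × F × F) (g : F) :
    traceWord F s p g = p.1 + tr (p.2.1 * g) + tr (p.2.2 * g ^ s) := rfl

lemma traceWord_add_add (hF : Fintype.card F = 2 ^ (2 * k)) (p : ZMod 2 × F × F) (g h : F) :
    traceWord F (2 ^ k + 1) p g + traceWord F (2 ^ k + 1) p (g + h) =
      tr (p.2.1 * h) + tr (p.2.2 * h ^ (2 ^ k + 1)) +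
        tr (frobTrace F k p.2.2 * h ^ 2 ^ k * g) := by
  obtain ⟨c, a, b⟩ := p
  have hsw : tr (b ^ 2 ^ k * h ^ 2 ^ k * g) = tr (b * h * g ^ 2 ^ k) := by
    rw [← trace_pow_two_pow k (b ^ 2 ^ k * h ^ 2 ^ k * g), mul_pow, mul_pow,
      pow_two_pow_pow_two_pow hF, pow_two_pow_pow_two_pow hF]
  have hexp : b * (g + h) ^ (2 ^ k + 1) = b * g ^ (2 ^ k + 1) + b * h ^ (2 ^ k + 1) +
      (b * h * g ^ 2 ^ k + b * h ^ 2 ^ k * g) := by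
    rw [pow_succ, add_pow_char_pow]; ring
  simp only [traceWord_apply, hexp, frobTrace_apply, add_mul, mul_add, map_add, hsw]
  linear_combination (CharTwo.add_self_eq_zero (c + tr (a * g) + tr (b * g ^ (2 ^ k + 1))))

lemma sq_sum_signChar_traceWord (hF : Fintype.card F = 2 ^ (2 * k)) {p : ZMod 2 × F × F}
    (hp : frobTrace F k p.2.2 ≠ 0) :
    (∑ g, signChar (traceWord F (2 ^ k + 1) p g)) ^ 2 = Fintype.card F := by
  set w := traceWord F (2 ^ k + 1) p with hw
  have hshift (g : F) : ∑ h, signChar (w h) = ∑ h, signChar (w (g + h)) :=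
    (Equiv.sum_comp (Equiv.addLeft g) fun h => signChar (w h)).symm
  calc (∑ g, signChar (w g)) ^ 2
      = ∑ g, signChar (w g) * ∑ h, signChar (w (g + h)) := by
        rw [sq, Finset.sum_mul]
        exact Finset.sum_congr rfl fun g _ => by rw [← hshift g]
    _ = ∑ h, ∑ g, signChar (w g + w (g + h)) := by
        simp_rw [Finset.mul_sum, signChar_add]
        exact Finset.sum_comm
    _ = ∑ h : F, if h = 0 then (Fintype.card F : ℤ) else 0 := by
        refine Finset.sum_congr rfl fun h _ => ?_
        simp_rw [hw, traceWord_add_add hF, signChar_add _ (tr (_ * _ * _)), ← Finset.mul_sum,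
          sum_signChar_trace_mul]
        by_cases hh : h = 0 <;> simp [hh, hp, signChar]
    _ = Fintype.card F := by simp

lemma sum_signChar_traceWord (hk : k ≠ 0) (hF : Fintype.card F = 2 ^ (2 * k))
    {p : ZMod 2 × F × F} (hp : frobTrace F k p.2.2 = 0) :
    ∑ g, signChar (traceWord F (2 ^ k + 1) p g) =
      signChar p.1 * if p.2.1 = 0 then (Fintype.card F : ℤ) else 0 := by
  rw [← sum_signChar_trace_mul, Finset.mul_sum]
  refine Finset.sum_congr rfl fun g _ => ?_
  rw [traceWord_apply, trace_mul_pow_eq_zero hk hF hp, add_zero, signChar_add]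

/-- The character sum of a trace word vanishes exactly for the nonconstant affine words. -/
lemma sum_signChar_traceWord_eq_zero_iff (hk : k ≠ 0) (hF : Fintype.card F = 2 ^ (2 * k))
    (p : ZMod 2 × F × F) :
    ∑ g, signChar (traceWord F (2 ^ k + 1) p g) = 0 ↔ p.2.1 ≠ 0 ∧ frobTrace F k p.2.2 = 0 := by
  have hc : (Fintype.card F : ℤ) ≠ 0 := by exact_mod_cast Fintype.card_ne_zero
  by_cases hp : frobTrace F k p.2.2 = 0
  · have : signChar p.1 ≠ 0 := fun h => by simpa [h] using signChar_mul_self p.1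
    simp [sum_signChar_traceWord hk hF hp, hp, this]
  · have := sq_sum_signChar_traceWord hF hp
    simp only [hp, and_false, iff_false]
    intro h
    rw [h, zero_pow two_ne_zero] at this
    exact hc this.symm

lemma sq_sum_signChar_traceWord_eq_card_iff (hk : k ≠ 0) (hF : Fintype.card F = 2 ^ (2 * k))
    (p : ZMod 2 × F × F) :
    (∑ g, signChar (traceWord F (2 ^ k + 1) p g)) ^ 2 = Fintype.card F ↔
      frobTrace F k p.2.2 ≠ 0 := by
  refine ⟨fun h hp => ?_, sq_sum_signChar_traceWord hF⟩
  have hc : (1 : ℤ) < Fintype.card F := by exact_mod_cast Fintype.one_lt_card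
  rw [sum_signChar_traceWord hk hF hp, mul_pow, sq, signChar_mul_self] at h
  split_ifs at h
  · nlinarith
  · simp at h; omega

lemma natCard_ker_traceWord (hk : k ≠ 0) (hF : Fintype.card F = 2 ^ (2 * k)) :
    Nat.card (LinearMap.ker (traceWord F (2 ^ k + 1))) = 2 ^ k := by
  have hc : (1 : ℤ) < Fintype.card F := by exact_mod_cast Fintype.one_lt_card
  have hmem (p : ZMod 2 × F × F) : p ∈ LinearMap.ker (traceWord F (2 ^ k + 1)) ↔
      (p.1 = 0 ∧ p.2.1 = 0) ∧ p.2.2 ∈ (frobTrace F k).ker := by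
    obtain ⟨c, a, b⟩ := p
    rw [LinearMap.mem_ker, AddMonoidHom.mem_ker]
    constructor
    · intro h
      have hsum : ∑ g, signChar (traceWord F (2 ^ k + 1) (c, a, b) g) = Fintype.card F := by
        simp [h, signChar]
      have hb : frobTrace F k b = 0 := by
        by_contra hb
        have := sq_sum_signChar_traceWord hF (p := (c, a, b)) hb
        rw [hsum] at this
        nlinarith
      have ha : a = 0 := by
        by_contra ha
        rw [(sum_signChar_traceWord_eq_zero_iff hk hF _).2 ⟨ha, hb⟩] at hsum
        omega
      have h0 := congr_fun h 0
      simp only [traceWord_apply] at h0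
      simp at h0
      exact ⟨⟨h0, ha⟩, hb⟩
    · rintro ⟨⟨rfl, rfl⟩, hb⟩
      ext g
      simp [traceWord_apply, trace_mul_pow_eq_zero hk hF hb]
  refine Eq.trans (Nat.card_congr ?_) (card_frobTrace_ker_and_range (F := F) hk hF).1
  exact
    { toFun := fun p => ⟨p.1.2.2, ((hmem p.1).1 p.2).2⟩
      invFun := fun b => ⟨(0, 0, b.1), (hmem _).2 ⟨⟨rfl, rfl⟩, b.2⟩⟩
      left_inv := fun p => by
        obtain ⟨⟨h1, h2⟩, -⟩ := (hmem p.1).1 p.2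
        ext <;> simp [h1, h2]
      right_inv := fun b => rfl }

lemma natCard_range_traceWord (hk : k ≠ 0) (hF : Fintype.card F = 2 ^ (2 * k)) :
    Nat.card (LinearMap.range (traceWord F (2 ^ k + 1))) = 2 ^ (3 * k + 1) := by
  have h := (traceWord F (2 ^ k + 1)).natCard_comp_eq fun _ => True
  simp only [and_true, natCard_ker_traceWord hk hF] at h
  refine Nat.eq_of_mul_eq_mul_right (by positivity : 0 < 2 ^ k) (h.symm.trans ?_)
  rw [Nat.card_congr (Equiv.subtypeUnivEquiv fun _ => trivial)]
  rw [Nat.card_prod, Nat.card_prod, Nat.card_zmod, Nat.card_eq_fintype_card, hF]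
  ring

lemma natCard_range_traceWord_sum_eq_zero (hk : k ≠ 0) (hF : Fintype.card F = 2 ^ (2 * k)) :
    Nat.card {y : F → ZMod 2 // y ∈ LinearMap.range (traceWord F (2 ^ k + 1)) ∧
      ∑ g, signChar (y g) = 0} = 2 * (2 ^ (2 * k) - 1) := by
  have h := (traceWord F (2 ^ k + 1)).natCard_comp_eq fun y => ∑ g, signChar (y g) = 0
  simp only [natCard_ker_traceWord hk hF, sum_signChar_traceWord_eq_zero_iff hk hF] at h
  refine Nat.eq_of_mul_eq_mul_right (by positivity : 0 < 2 ^ k) (h.symm.trans ?_)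
  have e : {p : ZMod 2 × F × F // p.2.1 ≠ 0 ∧ frobTrace F k p.2.2 = 0} ≃
      ZMod 2 × {a : F // a ≠ 0} × (frobTrace F k).ker :=
    { toFun := fun p => (p.1.1, ⟨p.1.2.1, p.2.1⟩, ⟨p.1.2.2, p.2.2⟩)
      invFun := fun p => ⟨(p.1, p.2.1.1, p.2.2.1), p.2.1.2, p.2.2.2⟩
      left_inv := fun _ => rfl
      right_inv := fun _ => rfl }
  rw [Nat.card_congr e, Nat.card_prod, Nat.card_prod, Nat.card_zmod,
    (card_frobTrace_ker_and_range hk hF).1, Nat.card_eq_fintype_card, Fintype.card_subtype_compl,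
    Fintype.card_subtype_eq, hF, mul_assoc]

lemma natCard_range_traceWord_sq_sum_eq_card (hk : k ≠ 0)
    (hF : Fintype.card F = 2 ^ (2 * k)) :
    Nat.card {y : F → ZMod 2 // y ∈ LinearMap.range (traceWord F (2 ^ k + 1)) ∧
      (∑ g, signChar (y g)) ^ 2 = Fintype.card F} = 2 * ((2 ^ k - 1) * 2 ^ (2 * k)) := by
  have h := (traceWord F (2 ^ k + 1)).natCard_comp_eq fun y =>
    (∑ g, signChar (y g)) ^ 2 = Fintype.card F
  simp only [natCard_ker_traceWord hk hF, sq_sum_signChar_traceWord_eq_card_iff hk hF] at h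
  refine Nat.eq_of_mul_eq_mul_right (by positivity : 0 < 2 ^ k) (h.symm.trans ?_)
  have e : {p : ZMod 2 × F × F // frobTrace F k p.2.2 ≠ 0} ≃
      ZMod 2 × F × {b : F // ¬ b ∈ (frobTrace F k).ker} :=
    { toFun := fun p => (p.1.1, p.1.2.1, ⟨p.1.2.2, p.2⟩)
      invFun := fun p => ⟨(p.1, p.2.1, p.2.2.1), p.2.2.2⟩
      left_inv := fun _ => rfl
      right_inv := fun _ => rfl }
  have hker : Fintype.card {b : F // b ∈ (frobTrace F k).ker} = 2 ^ k := by
    rw [← Nat.card_eq_fintype_card]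
    exact (card_frobTrace_ker_and_range hk hF).1
  rw [Nat.card_congr e, Nat.card_prod, Nat.card_prod, Nat.card_zmod, Nat.card_eq_fintype_card,
    Nat.card_eq_fintype_card, Fintype.card_subtype_compl, hker, hF, two_mul k, pow_add,
    ← Nat.sub_one_mul]
  ring

lemma sum_signChar_mem_of_mem_range_traceWord (hk : k ≠ 0) (hF : Fintype.card F = 2 ^ (2 * k))
    {y : F → ZMod 2} (hy : y ∈ LinearMap.range (traceWord F (2 ^ k + 1))) :
    ∑ g, signChar (y g) = 0 ∨ (∑ g, signChar (y g)) ^ 2 = Fintype.card F ∨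
      ∑ g, signChar (y g) = Fintype.card F ∨ ∑ g, signChar (y g) = -Fintype.card F := by
  obtain ⟨p, rfl⟩ := hy
  by_cases hb : frobTrace F k p.2.2 = 0
  · have hs : signChar p.1 = 1 ∨ signChar p.1 = -1 := by
      generalize p.1 = c
      revert c; decide
    rw [sum_signChar_traceWord hk hF hb]
    split_ifs
    · rcases hs with hs | hs <;> simp [hs]
    · simp
  · exact Or.inr (Or.inl (sq_sum_signChar_traceWord hF hb))

omit [Fintype F] [CharP F 2] in
lemma one_mem_range_traceWord (s : ℕ) : 1 ∈ LinearMap.range (traceWord F s) :=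
  ⟨(1, 0, 0), by ext g; simp [traceWord_apply]⟩

end TraceCode

lemma dualCode_eq_range (m e : ℕ) :
    dualCode m e = LinearMap.range (traceWord (GaloisField 2 m) (2 ^ e + 1)) := by
  ext y
  constructor
  · intro hy
    let L := (parF m).prod ((phiF m 1).prod (phiF m (2 ^ e + 1)))
    let φ : Module.Dual (ZMod 2) (GaloisField 2 m → ZMod 2) :=
      { toFun := fun c => ∑ g, c g * y g
        map_add' := fun c d => by simp [add_mul, Finset.sum_add_distrib]
        map_smul' := fun r c => by simp [mul_assoc, Finset.mul_sum] }
    have hφ : φ ∈ (LinearMap.ker L).dualAnnihilator := by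
      rw [Submodule.mem_dualAnnihilator]
      intro c hc
      refine hy c ?_
      simpa [L, extCode, LinearMap.ker_prod, and_assoc] using hc
    rw [← LinearMap.range_dualMap_eq_dualAnnihilator_ker] at hφ
    obtain ⟨ψ, hψ⟩ := hφ
    obtain ⟨a, ha⟩ := exists_trace_mul_eq
      (ψ ∘ₗ LinearMap.inr (ZMod 2) (ZMod 2) (GaloisField 2 m × GaloisField 2 m) ∘ₗ
        LinearMap.inl (ZMod 2) (GaloisField 2 m) (GaloisField 2 m))
    obtain ⟨b, hb⟩ := exists_trace_mul_eq
      (ψ ∘ₗ LinearMap.inr (ZMod 2) (ZMod 2) (GaloisField 2 m × GaloisField 2 m) ∘ₗ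
        LinearMap.inr (ZMod 2) (GaloisField 2 m) (GaloisField 2 m))
    refine ⟨(ψ (1, 0), a, b), ?_⟩
    ext g
    have hg := LinearMap.congr_fun hψ (Pi.single g 1)
    have hL : L (Pi.single g 1) = (1, 0) + ((0, (g, 0)) + (0, (0, g ^ (2 ^ e + 1)))) := by
      simp [L, parF, phiF, Pi.single_apply, apply_ite]
    have hr : φ (Pi.single g 1) = y g := by simp [φ, Pi.single_apply]
    rw [traceWord_apply, ← hr, ← hg, LinearMap.dualMap_apply, hL, map_add, map_add, ← ha, ← hb,
      add_assoc]
    rfl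
  · rintro ⟨⟨c₀, a, b⟩, rfl⟩ c hc
    obtain ⟨⟨h0, h1⟩, h2⟩ := hc
    have key (d : GaloisField 2 m) (s : ℕ) (h : phiF m s c = 0) :
        ∑ g, c g * Algebra.trace (ZMod 2) (GaloisField 2 m) (d * g ^ s) = 0 := by
      have : ∑ g, c g * Algebra.trace (ZMod 2) (GaloisField 2 m) (d * g ^ s) =
          Algebra.trace (ZMod 2) (GaloisField 2 m) (d * phiF m s c) := by
        simp only [phiF, LinearMap.coe_mk, AddHom.coe_mk, Finset.mul_sum, map_sum]
        refine Finset.sum_congr rfl fun g _ => ?_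
        rw [mul_left_comm, ← Algebra.smul_def, map_smul, smul_eq_mul]
      rw [this, h, mul_zero, map_zero]
    have k1 := key a 1 h1
    have k2 := key b _ h2
    have k0 : ∑ g, c g = 0 := h0
    simp only [pow_one] at k1
    simp only [traceWord_apply, mul_add, Finset.sum_add_distrib, k1, k2, ← Finset.sum_mul, k0]
    simp

lemma wt_eq_zero_iff {m : ℕ} (y : GaloisField 2 m → ZMod 2) : wt y = 0 ↔ y = 0 := by
  simp [wt, Finset.filter_eq_empty_iff, funext_iff]

/-- When `m ≥ 4` is even and `e = m/2`, the dual `C̄_e^⊥` has dimension `1 + 3m/2`,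
weight distribution as in Table V, and minimum distance `2^{m-1} - 2^{(m-2)/2}`. -/
theorem dualCode_weight_distribution_e_eq_half_m (m e : ℕ) (hm : 4 ≤ m)
    (hmeven : Even m) (he : e = m / 2) :
    Module.finrank (ZMod 2) (dualCode m e) = 1 + 3 * m / 2 ∧
    Nat.card {y : GaloisField 2 m → ZMod 2 // y ∈ dualCode m e ∧ wt y = 0} = 1 ∧
    Nat.card {y : GaloisField 2 m → ZMod 2 // y ∈ dualCode m e ∧ wt y = 2 ^ m} = 1 ∧
    Nat.card {y : GaloisField 2 m → ZMod 2 // y ∈ dualCode m e ∧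
        wt y = 2 ^ (m - 1) - 2 ^ ((m - 2) / 2)} = (2 ^ (m / 2) - 1) * 2 ^ m ∧
    Nat.card {y : GaloisField 2 m → ZMod 2 // y ∈ dualCode m e ∧
        wt y = 2 ^ (m - 1) + 2 ^ ((m - 2) / 2)} = (2 ^ (m / 2) - 1) * 2 ^ m ∧
    Nat.card {y : GaloisField 2 m → ZMod 2 // y ∈ dualCode m e ∧
        wt y = 2 ^ (m - 1)} = 2 ^ (m + 1) - 2 ∧
    (∀ y ∈ dualCode m e, wt y ∈ ({0, 2 ^ (m - 1) - 2 ^ ((m - 2) / 2), 2 ^ (m - 1),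
        2 ^ (m - 1) + 2 ^ ((m - 2) / 2), 2 ^ m} : Set ℕ)) ∧
    IsLeast {w : ℕ | ∃ y ∈ dualCode m e, y ≠ 0 ∧ wt y = w}
      (2 ^ (m - 1) - 2 ^ ((m - 2) / 2)) := by
  obtain ⟨k, rfl⟩ := hmeven
  obtain rfl : e = k := by omega
  obtain ⟨j, rfl⟩ : ∃ j, e = j + 1 := ⟨e - 1, by omega⟩
  have hk : j + 1 ≠ 0 := by omega
  have hF : Fintype.card (GaloisField 2 (j + 1 + (j + 1))) = 2 ^ (2 * (j + 1)) := by
    rw [← Nat.card_eq_fintype_card, GaloisField.card _ _ (by omega), two_mul]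
  have e1 : (j + 1 + (j + 1)) / 2 = j + 1 := by omega
  have e2 : (j + 1 + (j + 1) - 2) / 2 = j := by omega
  have e3 : j + 1 + (j + 1) - 1 = j + (j + 1) := by omega
  rw [e1, e2, e3]
  have hdim := natCard_range_traceWord hk hF
  have hmid := natCard_range_traceWord_sum_eq_zero hk hF
  have hbent := natCard_range_traceWord_sq_sum_eq_card hk hF
  have hone := one_mem_range_traceWord (F := GaloisField 2 (j + 1 + (j + 1))) (2 ^ (j + 1) + 1)
  have hvals (y) (hy : y ∈ dualCode (j + 1 + (j + 1)) (j + 1)) :=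
    sum_signChar_mem_of_mem_range_traceWord hk hF (dualCode_eq_range _ _ ▸ hy)
  rw [← dualCode_eq_range] at hdim hmid hbent hone
  set C := dualCode (j + 1 + (j + 1)) (j + 1)
  have hsum (y : GaloisField 2 (j + 1 + (j + 1)) → ZMod 2) :
      ∑ g, signChar (y g) = 2 ^ (2 * (j + 1)) - 2 * (wt y : ℤ) := by
    rw [sum_signChar, hF]
    push_cast
    rfl
  have hr : 2 ≤ 2 ^ j := Nat.le_self_pow (by omega) 2
  have hcard : 2 ^ (2 * (j + 1)) = 4 * (2 ^ j * 2 ^ j) := by ring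
  have hcard' : 2 ^ (j + 1 + (j + 1)) = 4 * (2 ^ j * 2 ^ j) := by ring
  have hhalf : 2 ^ (j + (j + 1)) = 2 * (2 ^ j * 2 ^ j) := by ring
  have hrr : 2 * 2 ^ j ≤ 2 ^ j * 2 ^ j := Nat.mul_le_mul_right _ hr
  have hsq : (2 ^ (2 * (j + 1)) : ℤ) = (2 * 2 ^ j) ^ 2 := by ring
  have hcardZ : (2 ^ (2 * (j + 1)) : ℤ) = 4 * (2 ^ j * 2 ^ j : ℕ) := by push_cast; ring
  have hrZ : (2 * 2 ^ j : ℤ) = 2 * (2 ^ j : ℕ) := by push_cast; ring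
  have hcount {w : ℕ} {t : ℤ} (h : (2 ^ (2 * (j + 1)) : ℤ) - 2 * w = t) :
      Nat.card {y // y ∈ C ∧ wt y = w} = Nat.card {y // y ∈ C ∧ ∑ g, signChar (y g) = t} := by
    refine Nat.card_congr (Equiv.subtypeEquivRight fun y => and_congr_right fun _ => ?_)
    rw [hsum, ← h]
    omega
  have hlow : Nat.card {y // y ∈ C ∧ ∑ g, signChar (y g) = 2 * 2 ^ j} =
      (2 ^ (j + 1) - 1) * 2 ^ (2 * (j + 1)) := by
    rw [hF, Nat.cast_pow, Nat.cast_ofNat, hsq,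
      natCard_sum_signChar_sq_eq_sq C hone (by positivity)] at hbent
    omega
  have hzero : Nat.card {y // y ∈ C ∧ wt y = 0} = 1 := by
    rw [Nat.card_eq_one_iff_unique]
    refine ⟨⟨fun y z => Subtype.ext ?_⟩, ⟨⟨0, C.zero_mem, (wt_eq_zero_iff 0).2 rfl⟩⟩⟩
    rw [(wt_eq_zero_iff _).1 y.2.2, (wt_eq_zero_iff _).1 z.2.2]
  have hweight {y} (hy : y ∈ C) : wt y = 0 ∨ wt y = 2 ^ (j + (j + 1)) - 2 ^ j ∨
      wt y = 2 ^ (j + (j + 1)) ∨ wt y = 2 ^ (j + (j + 1)) + 2 ^ j ∨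
      wt y = 2 ^ (j + 1 + (j + 1)) := by
    have h := hvals y hy
    rw [hF, Nat.cast_pow, Nat.cast_ofNat] at h
    nth_rw 1 [hsq] at h
    rw [sq_eq_sq_iff_eq_or_eq_neg, hsum, hrZ, hcardZ] at h
    rw [hhalf, hcard']
    generalize 2 ^ j * 2 ^ j = q at *
    generalize 2 ^ j = r at *
    omega
  have hlow' : Nat.card {y // y ∈ C ∧ wt y = 2 ^ (j + (j + 1)) - 2 ^ j} =
      (2 ^ (j + 1) - 1) * 2 ^ (j + 1 + (j + 1)) := by
    rw [hcount (t := 2 * 2 ^ j), hlow, two_mul (j + 1)]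
    rw [hcardZ, hrZ, hhalf]
    omega
  refine ⟨?_, hzero, ?_, hlow', ?_, ?_, fun y hy => by simpa using hweight hy, ?_, ?_⟩
  · have h : 2 ^ Module.finrank (ZMod 2) C = 2 ^ (3 * (j + 1) + 1) := by
      rw [← hdim, Module.natCard_eq_pow_finrank (K := ZMod 2) (V := C), Nat.card_zmod]
    have := Nat.pow_right_injective le_rfl h
    omega
  · rw [hcount (t := -2 ^ (2 * (j + 1))), natCard_sum_signChar_eq_neg C hone,
      ← hcount (w := 0) (by simp), hzero]
    rw [hcardZ, hcard']
    omega
  · rw [hcount (t := -(2 * 2 ^ j)), natCard_sum_signChar_eq_neg C hone, hlow, two_mul (j + 1)]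
    rw [hcardZ, hrZ, hhalf]
    omega
  · rw [hcount (t := 0), hmid, pow_succ, two_mul (j + 1)]
    · omega
    · rw [hcardZ, hhalf]
      omega
  · have hpos : 0 < Nat.card {y // y ∈ C ∧ wt y = 2 ^ (j + (j + 1)) - 2 ^ j} := by
      rw [hlow']
      have : 1 < 2 ^ (j + 1) := Nat.one_lt_two_pow hk
      exact Nat.mul_pos (by omega) (by positivity)
    obtain ⟨⟨y, hy, hwt⟩⟩ := (Nat.card_pos_iff.1 hpos).1
    refine ⟨y, hy, fun h => ?_, hwt⟩
    rw [(wt_eq_zero_iff y).2 h, hhalf] at hwt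
    omega
  · rintro w ⟨y, hy, hne, rfl⟩
    have hne' := mt (wt_eq_zero_iff y).1 hne
    have h := hweight hy
    rw [hhalf, hcard'] at *
    omega
end

section
/- Let m ≥ 4 and let e be an integer with 1 ≤ e ≤ m/2. Consider the nonempty finite subsets S of F∖{0}, where F = GF(2^m), with ∑_{g∈S} g = 0 and ∑_{g∈S} g^{2^e+1} = 0. The minimum possible value of |S| over all such S equals 5 if gcd(e,m) = 1, and equals 3 if gcd(e,m) > 1. (That is, the binary cyclic code C_e of length 2^m−1 with zeros α and α^{1+2^e} has minimum distance 5 if gcd(e,m)=1 and 3 otherwise.) -/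
open Finset

section GoldCode

variable {F : Type*} [Field F]

/-- The Gold power map is quadratic in characteristic two: its translate by `c` differs from it by
an additive map and a constant. -/
lemma add_pow_two_pow_add_one [CharP F 2] (e : ℕ) (x c : F) :
    (x + c) ^ (2 ^ e + 1) =
      x ^ (2 ^ e + 1) + c * x ^ 2 ^ e + c ^ 2 ^ e * x + c ^ (2 ^ e + 1) := by
  rw [pow_succ, add_pow_char_pow]
  ring

/-- In a field with `2 ^ m` elements, `x ↦ x ^ (2 ^ e)` fixes only `0` and `1` if
`e` and `m` are coprime. -/
lemma eq_one_of_pow_two_pow_eq_self [Fintype F] {m e : ℕ} (hF : Fintype.card F = 2 ^ m)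
    (h : Nat.gcd e m = 1) {t : F} (ht : t ≠ 0) (hte : t ^ 2 ^ e = t) : t = 1 := by
  have h1 : t ^ (2 ^ e - 1) = 1 := by
    apply mul_right_cancel₀ ht
    rw [← pow_succ, Nat.sub_add_cancel Nat.one_le_two_pow, hte, one_mul]
  have h2 : t ^ (2 ^ m - 1) = 1 := hF ▸ FiniteField.pow_card_sub_one_eq_one t ht
  have h3 := Nat.dvd_gcd (orderOf_dvd_of_pow_eq_one h1) (orderOf_dvd_of_pow_eq_one h2)
  rw [Nat.pow_sub_one_gcd_pow_sub_one, h] at h3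
  exact orderOf_eq_one_iff.mp (Nat.dvd_one.mp h3)

/-- If `e` and `m` are not coprime, `x ↦ x ^ (2 ^ e)` has a fixed point other than `0` and `1`
in a field with `2 ^ m` elements. -/
lemma exists_pow_two_pow_eq_self [Fintype F] {m e : ℕ} (hm : m ≠ 0)
    (hF : Fintype.card F = 2 ^ m) (h : Nat.gcd e m ≠ 1) :
    ∃ t : F, t ≠ 0 ∧ t ≠ 1 ∧ t ^ 2 ^ e = t := by
  obtain ⟨u, hu⟩ := IsCyclic.exists_ofOrder_eq_natCard (α := Fˣ)
  rw [Nat.card_units, Nat.card_eq_fintype_card, hF] at hu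
  have hg : 2 ≤ Nat.gcd e m := by
    have := Nat.gcd_pos_of_pos_right e (Nat.pos_of_ne_zero hm)
    omega
  have hg' : 2 ^ 2 ≤ 2 ^ Nat.gcd e m := Nat.pow_le_pow_right two_pos hg
  have hm' : 1 < 2 ^ m := Nat.one_lt_two_pow hm
  obtain ⟨k, hk⟩ := Nat.pow_sub_one_dvd_pow_sub_one 2 (Nat.gcd_dvd_right e m)
  obtain ⟨l, hl⟩ := Nat.pow_sub_one_dvd_pow_sub_one 2 (Nat.gcd_dvd_left e m)
  have hk0 : 0 < k := by
    rcases Nat.eq_zero_or_pos k with rfl | hk0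
    · omega
    · exact hk0
  refine ⟨((u ^ k : Fˣ) : F), Units.ne_zero _, fun h1 => ?_, ?_⟩
  · have h1' : u ^ k = 1 := Units.ext h1
    have h2 := Nat.le_of_dvd hk0 (orderOf_dvd_of_pow_eq_one h1')
    rw [hu, hk] at h2
    nlinarith [Nat.sub_add_cancel (Nat.one_le_two_pow (n := Nat.gcd e m))]
  · have h1 : (u ^ k) ^ (2 ^ e - 1) = 1 := by
      rw [← pow_mul, hl, ← mul_assoc, mul_comm k, ← hk, ← hu, pow_mul, pow_orderOf_eq_one, one_pow]
    have h2 : (u ^ k) ^ 2 ^ e = u ^ k := by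
      rw [← Nat.sub_add_cancel (Nat.one_le_two_pow (n := e)), pow_succ, h1, one_mul]
    exact_mod_cast congrArg Units.val h2

/-- The Gold function is almost perfect nonlinear: no four distinct points have both
vanishing sum and vanishing sum of values. -/
lemma card_ne_four_of_sum_eq_zero [CharP F 2] [Fintype F] {m e : ℕ}
    (hF : Fintype.card F = 2 ^ m) (h : Nat.gcd e m = 1) {S : Finset F}
    (h1 : ∑ g ∈ S, g = 0) (h2 : ∑ g ∈ S, g ^ (2 ^ e + 1) = 0) : #S ≠ 4 := by
  classical
  intro hS
  obtain ⟨a, b, c, d, hab, hac, had, hbc, hbd, hcd, rfl⟩ := Finset.card_eq_four.mp hS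
  simp only [sum_insert, mem_insert, mem_singleton, sum_singleton, hab, hac, had, hbc, hbd, hcd,
    or_self, not_false_eq_true] at h1 h2
  have two : (2 : F) = 0 := CharTwo.two_eq_zero
  have hd : d = (a + b) + c := by linear_combination h1 - (a + b + c) * two
  have hx : a + c ≠ 0 := fun h0 => hac (CharTwo.add_eq_zero.mp h0)
  have hy : b + c ≠ 0 := fun h0 => hbc (CharTwo.add_eq_zero.mp h0)
  have key : (a + c) ^ 2 ^ e * (b + c) = (a + c) * (b + c) ^ 2 ^ e := by
    rw [hd, pow_succ (a + b + c)] at h2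
    simp only [add_pow_char_pow, pow_succ] at h2 ⊢
    linear_combination h2 - (a ^ 2 ^ e * a + b ^ 2 ^ e * b + c ^ 2 ^ e * c
      + a * b ^ 2 ^ e + a * c ^ 2 ^ e + c * b ^ 2 ^ e) * two
  have ht := eq_one_of_pow_two_pow_eq_self hF h (div_ne_zero hx hy) (by
    rw [div_pow, div_eq_div_iff (pow_ne_zero _ hy) hy, key])
  exact hab (add_right_cancel ((div_eq_one_iff_eq hy).mp ht))

/-- Six distinct points with vanishing sum and vanishing sum of Gold values exist. -/
lemma exists_card_eq_six_of_sum_eq_zero [CharP F 2] [Fintype F] {m e : ℕ} (hm : 4 ≤ m)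
    (hF : Fintype.card F = 2 ^ m) (h : Nat.gcd e m = 1) :
    ∃ S : Finset F, #S = 6 ∧ ∑ g ∈ S, g = 0 ∧ ∑ g ∈ S, g ^ (2 ^ e + 1) = 0 := by
  classical
  have hq : 2 ^ 4 ≤ Fintype.card F := hF ▸ Nat.pow_le_pow_right two_pos hm
  have hcard : #(univ : Finset (F × F)) < #(powersetCard 3 (univ : Finset F)) := by
    rw [card_powersetCard, card_univ, card_univ, Fintype.card_prod]
    obtain ⟨n, hn⟩ := Nat.exists_eq_add_of_le' (show 2 ≤ Fintype.card F by omega)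
    have h3 : (n + 2).choose 3 * 6 = (n + 2) * (n + 1) * n := by
      have := Nat.descFactorial_eq_factorial_mul_choose (n + 2) 3
      simp [Nat.descFactorial, Nat.factorial] at this
      linarith
    rw [hn] at hq ⊢
    have : 14 ≤ n := by omega
    nlinarith
  obtain ⟨A, hA, B, hB, hne, hAB⟩ := exists_ne_map_eq_of_card_lt_of_maps_to hcard
    (f := fun T => (∑ g ∈ T, g, ∑ g ∈ T, g ^ (2 ^ e + 1))) (fun _ _ => mem_univ _)
  rw [mem_powersetCard_univ] at hA hB
  simp only [Prod.mk.injEq] at hAB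
  have hsum (f : F → F) (hf : ∑ g ∈ A, f g = ∑ g ∈ B, f g) :
      ∑ g ∈ (A \ B) ∪ (B \ A), f g = 0 := by
    rw [sum_union disjoint_sdiff_sdiff, CharTwo.add_eq_zero]
    have hA' := sum_inter_add_sum_sdiff A B f
    have hB' := sum_inter_add_sum_sdiff B A f
    rw [inter_comm] at hB'
    exact add_left_cancel (hA'.trans (hf.trans hB'.symm))
  have hs1 := hsum _ hAB.1
  have hs2 := hsum _ hAB.2
  refine ⟨_, ?_, hs1, hs2⟩
  have h4 := card_ne_four_of_sum_eq_zero hF h hs1 hs2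
  have hU := card_union_of_disjoint (disjoint_sdiff_sdiff : Disjoint (A \ B) (B \ A))
  have hcA := card_inter_add_card_sdiff A B
  have hcB := card_inter_add_card_sdiff B A
  rw [inter_comm] at hcB
  have h0 : #(A \ B) ≠ 0 := fun h0 =>
    hne (eq_of_subset_of_card_le (sdiff_eq_empty_iff_subset.mp (card_eq_zero.mp h0)) (by omega))
  have h1 : #((A \ B) ∪ (B \ A)) ≠ 2 := fun h1 => by
    obtain ⟨x, y, hxy, hS⟩ := card_eq_two.mp h1
    rw [hS, sum_pair hxy] at hs1
    exact hxy (CharTwo.add_eq_zero.mp hs1)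
  omega

/-- Sets of even size with vanishing sum and vanishing sum of Gold values are preserved by
translation. -/
lemma sum_image_add_right_eq_zero [CharP F 2] [DecidableEq F] {e : ℕ} {S : Finset F} (c : F)
    (hS : Even #S) (h1 : ∑ g ∈ S, g = 0) (h2 : ∑ g ∈ S, g ^ (2 ^ e + 1) = 0) :
    ∑ g ∈ S.image (· + c), g = 0 ∧ ∑ g ∈ S.image (· + c), g ^ (2 ^ e + 1) = 0 := by
  have hc : (#S : F) = 0 := (CharP.cast_eq_zero_iff F 2 _).mpr hS.two_dvd
  have h3 : ∑ g ∈ S, g ^ 2 ^ e = 0 := by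
    rw [← sum_pow_char_pow, h1, zero_pow (by positivity)]
  rw [sum_image (add_left_injective c).injOn, sum_image (add_left_injective c).injOn]
  constructor
  · simp [sum_add_distrib, h1, hc]
  · simp_rw [add_pow_two_pow_add_one, sum_add_distrib]
    rw [← mul_sum, ← mul_sum, h1, h2, h3]
    simp [hc]

end GoldCode

/-- The minimum cardinality of a nonempty subset `S` of `F∖{0}`, `F = GF(2^m)`, with
`∑_{g∈S} g = 0` and `∑_{g∈S} g^{2^e+1} = 0` is `5` if `gcd(e,m) = 1` and `3` if
`gcd(e,m) > 1`; i.e. the cyclic code `C_e` of length `2^m - 1` has minimum distance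
`5` or `3` accordingly. -/
theorem min_distance_cyclic_code (m : ℕ) (hm : 4 ≤ m)
    (e : ℕ) (he1 : 1 ≤ e) (hem : 2 * e ≤ m)
    (F : Type) [Field F] [Fintype F] (hF : Fintype.card F = 2 ^ m) :
    IsLeast {n : ℕ | ∃ S : Finset F, S.Nonempty ∧ S.card = n ∧ (0 : F) ∉ S ∧
        (∑ g ∈ S, g = 0) ∧ (∑ g ∈ S, g ^ (2 ^ e + 1) = 0)}
      (if Nat.gcd e m = 1 then 5 else 3) := by
  classical
  have : Fact (Nat.Prime 2) := ⟨Nat.prime_two⟩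
  have : CharP F 2 := charP_of_card_eq_prime_pow hF
  have three_le {S : Finset F} (hne : S.Nonempty) (h0 : (0 : F) ∉ S) (h1 : ∑ g ∈ S, g = 0) :
      3 ≤ #S := by
    have hpos := hne.card_pos
    by_contra! hlt
    obtain hS | hS : #S = 1 ∨ #S = 2 := by omega
    · obtain ⟨a, rfl⟩ := card_eq_one.mp hS
      simp_all
    · obtain ⟨a, b, hab, rfl⟩ := card_eq_two.mp hS
      rw [sum_pair hab] at h1
      exact hab (CharTwo.add_eq_zero.mp h1)
  split_ifs with h
  · refine ⟨?_, ?_⟩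
    · obtain ⟨S, hS, h1, h2⟩ := exists_card_eq_six_of_sum_eq_zero hm hF h
      obtain ⟨c, hc⟩ : S.Nonempty := card_pos.mp (by omega)
      obtain ⟨h1', h2'⟩ := sum_image_add_right_eq_zero c (hS ▸ by decide) h1 h2
      have h0 : (0 : F) ∈ S.image (· + c) := mem_image.mpr ⟨c, hc, CharTwo.add_self_eq_zero c⟩
      have h5 : #((S.image (· + c)).erase 0) = 5 := by
        rw [card_erase_of_mem h0, card_image_of_injective _ (add_left_injective c), hS]
      refine ⟨_, card_pos.mp (by omega), h5, notMem_erase _ _, ?_, ?_⟩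
      · rwa [sum_erase (f := fun g => g) _ rfl]
      · rwa [sum_erase _ (zero_pow (Nat.succ_ne_zero _))]
    · rintro n ⟨S, hne, rfl, h0, h1, h2⟩
      have h3 := three_le hne h0 h1
      have h4 := card_ne_four_of_sum_eq_zero hF h h1 h2
      have h4' := card_ne_four_of_sum_eq_zero hF h (S := insert 0 S)
        (by rwa [sum_insert h0, zero_add])
        (by rwa [sum_insert h0, zero_pow (Nat.succ_ne_zero _), zero_add])
      rw [card_insert_of_notMem h0] at h4'
      omega
  · refine ⟨?_, fun n ⟨S, hne, hn, h0, h1, _⟩ => hn ▸ three_le hne h0 h1⟩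
    obtain ⟨t, ht0, ht1, ht⟩ := exists_pow_two_pow_eq_self (by omega) hF h
    have two : (2 : F) = 0 := CharTwo.two_eq_zero
    have ht2 : 1 + t ≠ 0 := fun h0 => ht1 (CharTwo.add_eq_zero.mp h0).symm
    have hmem : (1 : F) ∉ ({t, 1 + t} : Finset F) := by simp [ht0, ht1.symm]
    have hmem' : t ≠ 1 + t := by simp
    refine ⟨{1, t, 1 + t}, insert_nonempty _ _, ?_, ?_, ?_, ?_⟩
    · rw [card_insert_of_notMem hmem, card_pair hmem']
    · simp [ht0.symm, ht2.symm]
    · rw [sum_insert hmem, sum_pair hmem']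
      linear_combination (1 + t) * two
    · rw [sum_insert hmem, sum_pair hmem']
      simp only [pow_succ, add_pow_char_pow, ht, one_pow]
      linear_combination (1 + t + t ^ 2) * two
end
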